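/- For every w ∈ A0_xy and every w' ∈ A+_xy: (F0·F+)_{w,x} = (F+·F0)_{w,x} = ((F0)²)_{w',x} = 0, ((F+)²)_{w,x} = q^{i+1}·[n−k−i], and (F0·F+)_{w',x} = (F+·F0)_{w',x} = (q−1)·[i]. -/

import Mathlib

open scoped Classical

noncomputable section

variable {F V : Type} [Field F] [AddCommGroup V] [Module F V]

/-- `v` covers `u` in the projective geometry `P`. -/
def Covers (u v : Submodule F V) : Prop :=
  u ≤ v ∧ Module.finrank F ↥v = Module.finrank F ↥u + 1

/-- `v` slash-covers `u` (relative to the fixed subspace `y`). -/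
def SlashCovers (y u v : Submodule F V) : Prop :=
  Covers u v ∧ Module.finrank F ↥(v ⊓ y) = Module.finrank F ↥(u ⊓ y) + 1

/-- `v` backslash-covers `u` (relative to the fixed subspace `y`). -/
def BackslashCovers (y u v : Submodule F V) : Prop :=
  Covers u v ∧ Module.finrank F ↥(v ⊓ y) = Module.finrank F ↥(u ⊓ y)

/-- `q` raised to a real exponent, as a complex number. -/
def qpow (q : ℕ) (e : ℝ) : ℂ := (((q : ℝ) ^ e : ℝ) : ℂ)

/-- The Gaussian bracket `[m] = (q^m - 1)/(q - 1)` as a rational number. -/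
def gaussQ (q m : ℕ) : ℚ := ((q : ℚ) ^ m - 1) / ((q : ℚ) - 1)

/-- The Gaussian bracket `[m] = (q^m - 1)/(q - 1)` as a complex number. -/
def gaussC (q m : ℕ) : ℂ := ((q : ℂ) ^ m - 1) / ((q : ℂ) - 1)

/-- The diagonal matrix `K1`; the `(u,u)` entry is `q^(k/2 - i)` for `u ∈ P_{i,j}`. -/
def matK1 (q k : ℕ) (y : Submodule F V) : Matrix (Submodule F V) (Submodule F V) ℂ :=
  Matrix.diagonal fun u => qpow q ((k : ℝ) / 2 - (Module.finrank F ↥(u ⊓ y) : ℝ))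

/-- The diagonal matrix `K2`; the `(u,u)` entry is `q^(j - (n-k)/2)` for `u ∈ P_{i,j}`. -/
def matK2 (q n k : ℕ) (y : Submodule F V) : Matrix (Submodule F V) (Submodule F V) ℂ :=
  Matrix.diagonal fun u =>
    qpow q (((Module.finrank F ↥u : ℝ) - (Module.finrank F ↥(u ⊓ y) : ℝ))
      - ((n : ℝ) - (k : ℝ)) / 2)

/-- The 0-1 matrix `L1`; the `(u,v)` entry is `1` iff `v` slash-covers `u`. -/
def matL1 (y : Submodule F V) : Matrix (Submodule F V) (Submodule F V) ℂ :=
  Matrix.of fun u v => if SlashCovers y u v then (1 : ℂ) else 0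

/-- The 0-1 matrix `L2`; the `(u,v)` entry is `1` iff `v` backslash-covers `u`. -/
def matL2 (y : Submodule F V) : Matrix (Submodule F V) (Submodule F V) ℂ :=
  Matrix.of fun u v => if BackslashCovers y u v then (1 : ℂ) else 0

/-- `R1 = L1ᵀ`. -/
def matR1 (y : Submodule F V) : Matrix (Submodule F V) (Submodule F V) ℂ := Matrix.transpose (matL1 y)

/-- `R2 = L2ᵀ`. -/
def matR2 (y : Submodule F V) : Matrix (Submodule F V) (Submodule F V) ℂ := Matrix.transpose (matL2 y)

/-- `R = L1 · R2`. -/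
def matR [Fintype (Submodule F V)] (y : Submodule F V) :
    Matrix (Submodule F V) (Submodule F V) ℂ := matL1 y * matR2 y

/-- `L = R1 · L2`. -/
def matL [Fintype (Submodule F V)] (y : Submodule F V) :
    Matrix (Submodule F V) (Submodule F V) ℂ := matR1 y * matL2 y

/-- The 0-1 matrix `F0`. -/
def matF0 (y : Submodule F V) : Matrix (Submodule F V) (Submodule F V) ℂ :=
  Matrix.of fun u v =>
    if SlashCovers y u (u ⊔ v) ∧ SlashCovers y v (u ⊔ v) ∧
        BackslashCovers y (u ⊓ v) u ∧ BackslashCovers y (u ⊓ v) v then (1 : ℂ) else 0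

/-- The 0-1 matrix `F+`. -/
def matFp (y : Submodule F V) : Matrix (Submodule F V) (Submodule F V) ℂ :=
  Matrix.of fun u v =>
    if BackslashCovers y u (u ⊔ v) ∧ BackslashCovers y v (u ⊔ v) then (1 : ℂ) else 0

/-- The 0-1 matrix `F-`. -/
def matFm (y : Submodule F V) : Matrix (Submodule F V) (Submodule F V) ℂ :=
  Matrix.of fun u v =>
    if SlashCovers y (u ⊓ v) u ∧ SlashCovers y (u ⊓ v) v then (1 : ℂ) else 0

/-- The vertex set `X` of the Grassmann graph: `k`-dimensional subspaces of `V`. -/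
abbrev GrassVertex (F V : Type) [Field F] [AddCommGroup V] [Module F V] (k : ℕ) :=
  {z : Submodule F V // Module.finrank F ↥z = k}

/-- The Grassmann graph `J_q(n,k)`: vertices are adjacent iff their intersection
has dimension `k - 1`. -/
def Grass (F V : Type) [Field F] [AddCommGroup V] [Module F V] (k : ℕ) :
    SimpleGraph (GrassVertex F V k) :=
  SimpleGraph.fromRel fun a b => Module.finrank F ↥(a.1 ⊓ b.1) = k - 1

/-- `B_xy = {z ∈ Γ(x) : ∂(z,y) = ∂(x,y) + 1}`. -/
def Bset {k : ℕ} (x y : GrassVertex F V k) : Set (GrassVertex F V k) :=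
  {z | (Grass F V k).Adj x z ∧ (Grass F V k).dist z y = (Grass F V k).dist x y + 1}

/-- `C_xy = {z ∈ Γ(x) : ∂(z,y) = ∂(x,y) - 1}`. -/
def Cset {k : ℕ} (x y : GrassVertex F V k) : Set (GrassVertex F V k) :=
  {z | (Grass F V k).Adj x z ∧ (Grass F V k).dist z y = (Grass F V k).dist x y - 1}

/-- `A_xy = {z ∈ Γ(x) : ∂(z,y) = ∂(x,y)}`. -/
def Aset {k : ℕ} (x y : GrassVertex F V k) : Set (GrassVertex F V k) :=
  {z | (Grass F V k).Adj x z ∧ (Grass F V k).dist z y = (Grass F V k).dist x y}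

/-- `A0_xy`. -/
def A0set {k : ℕ} (x y : GrassVertex F V k) : Set (GrassVertex F V k) :=
  {z | (Grass F V k).Adj x z ∧
    SlashCovers y.1 z.1 (z.1 ⊔ x.1) ∧ SlashCovers y.1 x.1 (z.1 ⊔ x.1) ∧
    BackslashCovers y.1 (z.1 ⊓ x.1) z.1 ∧ BackslashCovers y.1 (z.1 ⊓ x.1) x.1}

/-- `A+_xy`. -/
def Apset {k : ℕ} (x y : GrassVertex F V k) : Set (GrassVertex F V k) :=
  {z | (Grass F V k).Adj x z ∧
    BackslashCovers y.1 z.1 (z.1 ⊔ x.1) ∧ BackslashCovers y.1 x.1 (z.1 ⊔ x.1)}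

/-- `A-_xy`. -/
def Amset {k : ℕ} (x y : GrassVertex F V k) : Set (GrassVertex F V k) :=
  {z | (Grass F V k).Adj x z ∧
    SlashCovers y.1 (z.1 ⊓ x.1) z.1 ∧ SlashCovers y.1 (z.1 ⊓ x.1) x.1}

/-- The edge `wz` has type `0`. -/
def EdgeType0 {k : ℕ} (y w z : GrassVertex F V k) : Prop :=
  SlashCovers y.1 w.1 (w.1 ⊔ z.1) ∧ SlashCovers y.1 z.1 (w.1 ⊔ z.1) ∧
  BackslashCovers y.1 (w.1 ⊓ z.1) w.1 ∧ BackslashCovers y.1 (w.1 ⊓ z.1) z.1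

/-- The edge `wz` has type `+`. -/
def EdgeTypeP {k : ℕ} (y w z : GrassVertex F V k) : Prop :=
  BackslashCovers y.1 w.1 (w.1 ⊔ z.1) ∧ BackslashCovers y.1 z.1 (w.1 ⊔ z.1)

/-- The edge `wz` has type `-`. -/
def EdgeTypeM {k : ℕ} (y w z : GrassVertex F V k) : Prop :=
  SlashCovers y.1 (w.1 ⊓ z.1) w.1 ∧ SlashCovers y.1 (w.1 ⊓ z.1) z.1

open Module in
theorem finrank_sup_span_singleton [FiniteDimensional F V] {h : Submodule F V} {v : V}
    (hv : v ∉ h) : finrank F ↥(h ⊔ F ∙ v) = finrank F h + 1 := by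
  have h0 : v ≠ 0 := fun h0 => hv (h0 ▸ h.zero_mem)
  have h1 := Submodule.finrank_sup_add_finrank_inf_eq h (F ∙ v)
  have h2 : h ⊓ (F ∙ v) = ⊥ := by
    rw [← disjoint_iff]
    exact (Submodule.disjoint_span_singleton' h0).2 hv
  rw [h2, finrank_bot, finrank_span_singleton h0] at h1
  omega

open Module in
theorem eq_sup_span_singleton [FiniteDimensional F V] {h z : Submodule F V} {v : V}
    (hz : h ≤ z) (hd : finrank F z = finrank F h + 1) (hvz : v ∈ z) (hvh : v ∉ h) :
    h ⊔ F ∙ v = z := by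
  refine Submodule.eq_of_le_of_finrank_eq (sup_le hz ?_) ?_
  · simpa using hvz
  · rw [finrank_sup_span_singleton hvh, hd]

open Module in
/-- Double counting of the covers of `h` inside `T` that are not contained in `U`. -/
theorem card_covers_mul [Fintype F] [FiniteDimensional F V] [Fintype (Submodule F V)]
    {h U T : Submodule F V} (hU : h ≤ U) (hT : U ≤ T) :
    (Finset.univ.filter fun z : Submodule F V =>
      h ≤ z ∧ finrank F z = finrank F h + 1 ∧ z ≤ T ∧ ¬ z ≤ U).card *
      (Fintype.card F ^ (finrank F h + 1) - Fintype.card F ^ finrank F h) =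
      Fintype.card F ^ finrank F T - Fintype.card F ^ finrank F U := by
  have : Finite V := Module.finite_of_finite F
  have : Fintype V := Fintype.ofFinite V
  have card_diff : ∀ A B : Submodule F V, A ≤ B →
      (Finset.univ.filter fun v : V => v ∈ B ∧ v ∉ A).card =
        Fintype.card F ^ finrank F B - Fintype.card F ^ finrank F A := by
    intro A B hAB
    have hA : (Finset.univ.filter fun v : V => v ∈ A).card = Fintype.card F ^ finrank F A := by
      rw [← Module.card_eq_pow_finrank (K := F) (V := A), Fintype.card_subtype]
    have hB : (Finset.univ.filter fun v : V => v ∈ B).card = Fintype.card F ^ finrank F B := by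
      rw [← Module.card_eq_pow_finrank (K := F) (V := B), Fintype.card_subtype]
    rw [← hA, ← hB, ← Finset.card_sdiff_of_subset]
    · congr 1
      ext v
      simp
    · intro v
      simpa using @hAB v
  rw [← card_diff U T hT, Finset.card_eq_sum_card_fiberwise (f := fun v : V => h ⊔ F ∙ v)
    (t := Finset.univ.filter fun z : Submodule F V =>
      h ≤ z ∧ finrank F z = finrank F h + 1 ∧ z ≤ T ∧ ¬ z ≤ U)]
  · symm
    rw [← smul_eq_mul]
    apply Finset.sum_eq_card_nsmul
    intro z hz
    obtain ⟨hhz, hd, hzT, hzU⟩ := (Finset.mem_filter.1 hz).2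
    rw [← hd, ← card_diff h z hhz]
    congr 1
    ext v
    simp only [Finset.mem_filter, Finset.mem_univ, true_and]
    constructor
    · rintro ⟨⟨-, hvU⟩, rfl⟩
      exact ⟨le_sup_right (a := h) (Submodule.mem_span_singleton_self v), fun hv => hvU (hU hv)⟩
    · rintro ⟨hvz, hvh⟩
      have he := eq_sup_span_singleton hhz hd hvz hvh
      refine ⟨⟨hzT hvz, fun hvU => hzU ?_⟩, he⟩
      rw [← he]
      exact sup_le hU (by simpa using hvU)
  · intro v hv
    obtain ⟨hvT, hvU⟩ := (Finset.mem_filter.1 hv).2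
    have hvz : v ∈ h ⊔ F ∙ v :=
      le_sup_right (a := h) (Submodule.mem_span_singleton_self v)
    simp only [Finset.coe_filter, Finset.mem_univ, true_and, Set.mem_ofPred_eq]
    exact ⟨le_sup_left, finrank_sup_span_singleton fun hv => hvU (hU hv),
      sup_le (hU.trans hT) (by simpa using hvT), fun hle => hvU (hle hvz)⟩

open Module in
/-- The relation underlying `matF0`. -/
theorem typeZero_iff [FiniteDimensional F V] (y u v : Submodule F V) :
    (SlashCovers y u (u ⊔ v) ∧ SlashCovers y v (u ⊔ v) ∧
      BackslashCovers y (u ⊓ v) u ∧ BackslashCovers y (u ⊓ v) v) ↔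
    finrank F u = finrank F v ∧ finrank F ↥(u ⊓ v) + 1 = finrank F u ∧
      u ⊓ y = v ⊓ y ∧ u ⊔ y = v ⊔ y := by
  have e1 := Submodule.finrank_sup_add_finrank_inf_eq u v
  have e2 := Submodule.finrank_sup_add_finrank_inf_eq u y
  have e3 := Submodule.finrank_sup_add_finrank_inf_eq v y
  have e4 := Submodule.finrank_sup_add_finrank_inf_eq (u ⊔ v) y
  have l1 : u ⊓ v ⊓ y ≤ u ⊓ y := inf_le_inf_right _ inf_le_left
  have l2 : u ⊓ v ⊓ y ≤ v ⊓ y := inf_le_inf_right _ inf_le_right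
  have l3 : u ⊔ y ≤ u ⊔ v ⊔ y := sup_le_sup_right le_sup_left _
  have l4 : v ⊔ y ≤ u ⊔ v ⊔ y := sup_le_sup_right le_sup_right _
  constructor
  · rintro ⟨⟨⟨-, a1⟩, a2⟩, ⟨⟨-, b1⟩, b2⟩, ⟨⟨-, c1⟩, c2⟩, ⟨⟨-, d1⟩, d2⟩⟩
    refine ⟨by omega, by omega, ?_, ?_⟩
    · rw [← Submodule.eq_of_le_of_finrank_eq l1 c2.symm,
        ← Submodule.eq_of_le_of_finrank_eq l2 d2.symm]
    · rw [Submodule.eq_of_le_of_finrank_eq l3 (by omega),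
        Submodule.eq_of_le_of_finrank_eq l4 (by omega)]
  · rintro ⟨h1, h2, h3, h4⟩
    have h5 : u ⊓ v ⊓ y = u ⊓ y :=
      le_antisymm l1 (le_inf (le_inf inf_le_left (h3.le.trans inf_le_left)) inf_le_right)
    have h6 : u ⊔ v ⊔ y = u ⊔ y :=
      le_antisymm (sup_le (sup_le le_sup_left (le_sup_left.trans h4.ge)) le_sup_right) l3
    rw [h6] at e4
    have h7 := congrArg (fun z : Submodule F V => finrank F z) h3
    have h8 := congrArg (fun z : Submodule F V => finrank F z) h4
    refine ⟨⟨⟨le_sup_left, by omega⟩, by omega⟩, ⟨⟨le_sup_right, by omega⟩, by omega⟩,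
      ⟨⟨inf_le_left, by omega⟩, by rw [h5]⟩, ⟨⟨inf_le_right, by omega⟩, by rw [h5, h3]⟩⟩

open Module in
/-- The relation underlying `matFp`. -/
theorem typePlus_iff [FiniteDimensional F V] (y u v : Submodule F V) :
    (BackslashCovers y u (u ⊔ v) ∧ BackslashCovers y v (u ⊔ v)) ↔
    finrank F u = finrank F v ∧ finrank F ↥(u ⊓ v) + 1 = finrank F u ∧
      u ⊓ y = v ⊓ y ∧ u ⊔ y ≠ v ⊔ y := by
  have e1 := Submodule.finrank_sup_add_finrank_inf_eq u v
  have e2 := Submodule.finrank_sup_add_finrank_inf_eq u y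
  have e3 := Submodule.finrank_sup_add_finrank_inf_eq v y
  have e4 := Submodule.finrank_sup_add_finrank_inf_eq (u ⊔ v) y
  have l1 : u ⊓ y ≤ (u ⊔ v) ⊓ y := inf_le_inf_right _ le_sup_left
  have l2 : v ⊓ y ≤ (u ⊔ v) ⊓ y := inf_le_inf_right _ le_sup_right
  have l3 : u ⊔ y ≤ u ⊔ v ⊔ y := sup_le_sup_right le_sup_left _
  have l4 : v ⊔ y ≤ u ⊔ v ⊔ y := sup_le_sup_right le_sup_right _
  have m1 := Submodule.finrank_mono l1
  have m3 := Submodule.finrank_mono l3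
  constructor
  · rintro ⟨⟨⟨-, a1⟩, a2⟩, ⟨⟨-, b1⟩, b2⟩⟩
    refine ⟨by omega, by omega, ?_, ?_⟩
    · rw [Submodule.eq_of_le_of_finrank_eq l1 a2.symm,
        Submodule.eq_of_le_of_finrank_eq l2 b2.symm]
    · intro h
      have h6 : u ⊔ v ⊔ y = u ⊔ y :=
        le_antisymm (sup_le (sup_le le_sup_left (le_sup_left.trans h.ge)) le_sup_right) l3
      rw [h6] at e4
      omega
  · rintro ⟨h1, h2, h3, h4⟩
    have h7 := congrArg (fun z : Submodule F V => finrank F z) h3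
    have h8 : finrank F ↥(u ⊔ y) ≠ finrank F ↥(u ⊔ v ⊔ y) := by
      intro h
      refine h4 ?_
      rw [Submodule.eq_of_le_of_finrank_eq l3 h,
        Submodule.eq_of_le_of_finrank_eq l4 (by omega)]
    exact ⟨⟨⟨le_sup_left, by omega⟩, by omega⟩, ⟨⟨le_sup_right, by omega⟩, by omega⟩⟩

theorem matF0_apply [FiniteDimensional F V] (y u v : Submodule F V) :
    matF0 y u v = if Module.finrank F u = Module.finrank F v ∧
      Module.finrank F ↥(u ⊓ v) + 1 = Module.finrank F u ∧
      u ⊓ y = v ⊓ y ∧ u ⊔ y = v ⊔ y then 1 else 0 := by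
  simp only [matF0, Matrix.of_apply, typeZero_iff]

theorem matFp_apply [FiniteDimensional F V] (y u v : Submodule F V) :
    matFp y u v = if Module.finrank F u = Module.finrank F v ∧
      Module.finrank F ↥(u ⊓ v) + 1 = Module.finrank F u ∧
      u ⊓ y = v ⊓ y ∧ u ⊔ y ≠ v ⊔ y then 1 else 0 := by
  simp only [matFp, Matrix.of_apply, typePlus_iff]

theorem matF0_transpose (y : Submodule F V) : (matF0 y).transpose = matF0 y := by
  ext u v
  simp only [matF0, Matrix.transpose_apply, Matrix.of_apply, sup_comm v u, inf_comm v u]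
  congr 1
  exact propext ⟨fun ⟨a, b, c, d⟩ => ⟨b, a, d, c⟩, fun ⟨a, b, c, d⟩ => ⟨b, a, d, c⟩⟩

theorem matFp_transpose (y : Submodule F V) : (matFp y).transpose = matFp y := by
  ext u v
  simp only [matFp, Matrix.transpose_apply, Matrix.of_apply, sup_comm v u]
  congr 1
  exact propext and_comm

open Module in
/-- A subspace meeting two adjacent subspaces of the same dimension in hyperplanes contains
their intersection or is contained in their sum. -/
theorem inf_le_or_le_sup [FiniteDimensional F V] {x w z : Submodule F V}
    (hxz : finrank F x = finrank F z)
    (h1 : finrank F ↥(w ⊓ x) + 1 = finrank F x) (h2 : finrank F ↥(z ⊓ x) + 1 = finrank F x)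
    (h3 : finrank F ↥(w ⊓ z) + 1 = finrank F x) : w ⊓ x ≤ z ∨ z ≤ w ⊔ x := by
  by_cases hle : w ⊓ z ≤ x
  · left
    have h4 : w ⊓ z ≤ w ⊓ x := le_inf inf_le_left hle
    rw [← Submodule.eq_of_le_of_finrank_eq h4 (by omega)]
    exact inf_le_right
  · right
    have h4 : z ⊓ x < (z ⊓ x) ⊔ (w ⊓ z) :=
      lt_of_le_of_ne le_sup_left fun h => hle ((le_sup_right.trans h.ge).trans inf_le_right)
    have h5 := Submodule.finrank_lt_finrank_of_lt h4
    have h6 : (z ⊓ x) ⊔ (w ⊓ z) = z :=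
      Submodule.eq_of_le_of_finrank_le (sup_le inf_le_left inf_le_right) (by omega)
    calc z = (z ⊓ x) ⊔ (w ⊓ z) := h6.symm
      _ ≤ w ⊔ x := sup_le (inf_le_right.trans le_sup_right) (inf_le_left.trans le_sup_left)

theorem grass_adj_iff {k : ℕ} (a b : GrassVertex F V k) :
    (Grass F V k).Adj a b ↔ a ≠ b ∧ Module.finrank F ↥(a.1 ⊓ b.1) = k - 1 := by
  rw [Grass, SimpleGraph.fromRel_adj, inf_comm b.1, or_self]

open Module in
theorem le_finrank_inf_add_length [FiniteDimensional F V] {k : ℕ} {x y : GrassVertex F V k}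
    (p : (Grass F V k).Walk x y) : k ≤ finrank F ↥(x.1 ⊓ y.1) + p.length := by
  induction p with
  | @nil a => rw [inf_idem, a.2]; exact Nat.le_add_right _ _
  | @cons a b c hab p ih =>
    have h1 := ((grass_adj_iff a b).1 hab).2
    have hb := b.2
    have e1 := Submodule.finrank_sup_add_finrank_inf_eq (a.1 ⊓ b.1) (b.1 ⊓ c.1)
    have m1 := Submodule.finrank_mono
      (sup_le inf_le_right inf_le_left : (a.1 ⊓ b.1) ⊔ (b.1 ⊓ c.1) ≤ b.1)
    have m2 := Submodule.finrank_mono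
      (le_inf (inf_le_left.trans inf_le_left) (inf_le_right.trans inf_le_right) :
        (a.1 ⊓ b.1) ⊓ (b.1 ⊓ c.1) ≤ a.1 ⊓ c.1)
    rw [SimpleGraph.Walk.length_cons]
    omega

open Module in
theorem exists_walk_length_le [FiniteDimensional F V] {k : ℕ} (y : GrassVertex F V k) (d : ℕ) :
    ∀ x : GrassVertex F V k, k ≤ finrank F ↥(x.1 ⊓ y.1) + d →
      ∃ p : (Grass F V k).Walk x y, p.length ≤ d := by
  induction d with
  | zero =>
    intro x hx
    have h1 : x.1 ⊓ y.1 = x.1 :=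
      Submodule.eq_of_le_of_finrank_le inf_le_left (by rw [x.2]; simpa using hx)
    have h2 : x.1 ⊓ y.1 = y.1 :=
      Submodule.eq_of_le_of_finrank_le inf_le_right (by rw [y.2]; simpa using hx)
    obtain rfl : x = y := Subtype.ext (h1.symm.trans h2)
    exact ⟨.nil, le_rfl⟩
  | succ d ih =>
    intro x hx
    by_cases hxy : x = y
    · subst hxy
      exact ⟨.nil, Nat.zero_le _⟩
    have hnle : ¬ y.1 ≤ x.1 := fun h =>
      hxy (Subtype.ext (Submodule.eq_of_le_of_finrank_eq h (by rw [x.2, y.2])).symm)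
    have hlt : x.1 ⊓ y.1 < x.1 := by
      refine lt_of_le_of_ne inf_le_left fun h => hnle ?_
      rw [Submodule.eq_of_le_of_finrank_eq (inf_eq_left.1 h) (by rw [x.2, y.2])]
    obtain ⟨h, hle, hcov⟩ := exists_le_covBy_of_lt hlt
    obtain ⟨u, hux, huh⟩ := SetLike.exists_of_lt hcov.lt
    have hhx : h ⊔ F ∙ u = x.1 := by
      refine (hcov.eq_or_eq le_sup_left (sup_le hcov.le (by simpa using hux))).resolve_left ?_
      intro he
      exact huh (he.le (le_sup_right (a := h) (Submodule.mem_span_singleton_self u)))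
    have hdim := finrank_sup_span_singleton huh
    rw [hhx, x.2] at hdim
    obtain ⟨v, hvy, hvx⟩ := SetLike.not_le_iff_exists.1 hnle
    have hvh : v ∉ h := fun hv => hvx (hcov.le hv)
    have hvmem : v ∈ h ⊔ F ∙ v := le_sup_right (a := h) (Submodule.mem_span_singleton_self v)
    let x' : GrassVertex F V k := ⟨h ⊔ F ∙ v, by rw [finrank_sup_span_singleton hvh, hdim]⟩
    have hne : x ≠ x' := fun he => hvx ((congrArg Subtype.val he).ge hvmem)
    have hlt' : x.1 ⊓ x'.1 < x.1 := by
      refine lt_of_le_of_ne inf_le_left fun he => hne (Subtype.ext ?_)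
      exact Submodule.eq_of_le_of_finrank_eq (inf_eq_left.1 he) (by rw [x.2, x'.2])
    have hadj : (Grass F V k).Adj x x' := by
      refine (grass_adj_iff _ _).2 ⟨hne, ?_⟩
      have m1 := Submodule.finrank_lt_finrank_of_lt hlt'
      have m2 := Submodule.finrank_mono (le_inf hcov.le le_sup_left : h ≤ x.1 ⊓ x'.1)
      rw [x.2] at m1
      omega
    have hgrow : x.1 ⊓ y.1 < x'.1 ⊓ y.1 := by
      refine lt_of_le_of_ne (le_inf (hle.trans le_sup_left) inf_le_right) fun he => hvx ?_
      exact (he.ge.trans inf_le_left) (Submodule.mem_inf.2 ⟨hvmem, hvy⟩)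
    have m3 := Submodule.finrank_lt_finrank_of_lt hgrow
    obtain ⟨p, hp⟩ := ih x' (by omega)
    exact ⟨.cons hadj p, by rw [SimpleGraph.Walk.length_cons]; omega⟩

open Module in
theorem finrank_inf_add_dist [FiniteDimensional F V] {k : ℕ} (x y : GrassVertex F V k) :
    finrank F ↥(x.1 ⊓ y.1) + (Grass F V k).dist x y = k := by
  have hle := Submodule.finrank_mono (inf_le_left : x.1 ⊓ y.1 ≤ x.1)
  rw [x.2] at hle
  obtain ⟨p, hp⟩ := exists_walk_length_le y (k - finrank F ↥(x.1 ⊓ y.1)) x (by omega)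
  obtain ⟨p', hp'⟩ := SimpleGraph.Reachable.exists_walk_length_eq_dist ⟨p⟩
  have h1 := SimpleGraph.dist_le p
  have h2 := le_finrank_inf_add_length p'
  omega

open Module in
/-- An entry of `matFp ^ 2` at a pair of type zero. -/
theorem matFp_mul_matFp_apply [Fintype F] [FiniteDimensional F V] [Fintype (Submodule F V)]
    {k i : ℕ} {x y w : Submodule F V} (hx : finrank F x = k) (hw : finrank F w = k)
    (hy : finrank F y = k) (hi : finrank F ↥(x ⊓ y) + i = k)
    (hwx : finrank F ↥(w ⊓ x) + 1 = k) (he : w ⊓ y = x ⊓ y) (hs : w ⊔ y = x ⊔ y) :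
    (matFp y * matFp y) w x =
      (Fintype.card F : ℂ) ^ (i + 1) * gaussC (Fintype.card F) (finrank F V - k - i) := by
  set q := Fintype.card F with hq
  have hq1 : 1 < q := Fintype.one_lt_card
  have hU : w ⊓ x ≤ x ⊔ y := inf_le_right.trans le_sup_left
  have hcount := card_covers_mul hU (le_top : x ⊔ y ≤ ⊤)
  have e1 := Submodule.finrank_sup_add_finrank_inf_eq x y
  have hdU : finrank F ↥(x ⊔ y) = k + i := by omega
  have hn := Submodule.finrank_le (x ⊔ y)
  have hk : 1 ≤ k := by omega
  have hset : (Finset.univ.filter fun z : Submodule F V => w ⊓ x ≤ z ∧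
      finrank F z = finrank F ↥(w ⊓ x) + 1 ∧ z ≤ ⊤ ∧ ¬ z ≤ x ⊔ y) =
      Finset.univ.filter fun z : Submodule F V =>
        (finrank F w = finrank F z ∧ finrank F ↥(w ⊓ z) + 1 = finrank F w ∧
          w ⊓ y = z ⊓ y ∧ w ⊔ y ≠ z ⊔ y) ∧
        (finrank F z = finrank F x ∧ finrank F ↥(z ⊓ x) + 1 = finrank F z ∧
          z ⊓ y = x ⊓ y ∧ z ⊔ y ≠ x ⊔ y) := by
    ext z
    simp only [Finset.mem_filter, Finset.mem_univ, true_and]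
    constructor
    · rintro ⟨h1, h2, -, h4⟩
      have hzk : finrank F z = k := by omega
      have key : ∀ t : Submodule F V, finrank F t = k → w ⊓ x ≤ t → t ≤ x ⊔ y →
          t ⊓ z = w ⊓ x := by
        intro t ht h5 h6
        refine (Submodule.eq_of_le_of_finrank_le (le_inf h5 h1) ?_).symm
        have h7 : t ⊓ z < t := by
          refine lt_of_le_of_ne inf_le_left fun h => h4 ?_
          rw [← Submodule.eq_of_le_of_finrank_eq (inf_eq_left.1 h) (by omega)]
          exact h6
        have := Submodule.finrank_lt_finrank_of_lt h7
        omega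
      have kw := key w hw inf_le_left (le_sup_left.trans hs.le)
      have kx := key x hx inf_le_right le_sup_left
      have hzs : z ⊔ y ≠ x ⊔ y := fun h => h4 (le_sup_left.trans h.le)
      have hzy : z ⊓ y = x ⊓ y := by
        have h5 : x ⊓ y ≤ w ⊓ x := le_inf (he.ge.trans inf_le_left) inf_le_left
        refine le_antisymm (le_inf ?_ inf_le_right) (le_inf (h5.trans h1) inf_le_right)
        intro v hv
        by_contra hvx
        have h6 : v ∉ w ⊓ x := fun h => hvx (inf_le_right (a := w) h)
        apply h4
        rw [← eq_sup_span_singleton h1 h2 (Submodule.mem_inf.1 hv).1 h6]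
        refine sup_le hU ?_
        simpa using le_sup_right (a := x) (Submodule.mem_inf.1 hv).2
      refine ⟨⟨by omega, by rw [kw]; omega, he.trans hzy.symm, ?_⟩,
        by omega, by rw [inf_comm z x, kx]; omega, hzy, hzs⟩
      rw [hs]
      exact hzs.symm
    · rintro ⟨⟨a1, a2, a3, a4⟩, b1, b2, b3, b4⟩
      have h4 : ¬ z ≤ x ⊔ y := fun h =>
        b4 (Submodule.eq_of_le_of_finrank_eq (sup_le h le_sup_right) (by
          have e2 := Submodule.finrank_sup_add_finrank_inf_eq z y
          rw [b3] at e2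
          omega))
      refine ⟨?_, by omega, le_top, h4⟩
      refine (inf_le_or_le_sup (by omega) (by omega) (by omega) (by omega)).resolve_right ?_
      exact fun h => h4 (h.trans (sup_le (le_sup_left.trans hs.le) le_sup_left))
  rw [hset] at hcount
  have hentry : (matFp y * matFp y) w x = ((Finset.univ.filter fun z : Submodule F V =>
        (finrank F w = finrank F z ∧ finrank F ↥(w ⊓ z) + 1 = finrank F w ∧
          w ⊓ y = z ⊓ y ∧ w ⊔ y ≠ z ⊔ y) ∧
        (finrank F z = finrank F x ∧ finrank F ↥(z ⊓ x) + 1 = finrank F z ∧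
          z ⊓ y = x ⊓ y ∧ z ⊔ y ≠ x ⊔ y)).card : ℂ) := by
    simp only [Matrix.mul_apply, matFp_apply, ite_zero_mul_ite_zero, mul_one, Finset.sum_boole]
  rw [hentry]
  generalize Finset.card _ = N at hcount ⊢
  obtain ⟨m, rfl⟩ : ∃ m, k = m + 1 := ⟨k - 1, by omega⟩
  obtain ⟨r, hr⟩ : ∃ r, finrank F V = m + 1 + i + r := ⟨finrank F V - (m + 1 + i), by omega⟩
  have hm : finrank F ↥(w ⊓ x) = m := by omega
  rw [finrank_top, hr, hdU, hm] at hcount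
  have hr' : finrank F V - (m + 1) - i = r := by omega
  have c := congrArg (Nat.cast : ℕ → ℂ) hcount
  rw [Nat.cast_mul, Nat.cast_sub (Nat.pow_le_pow_right (by omega) (by omega)),
    Nat.cast_sub (Nat.pow_le_pow_right (by omega) (by omega))] at c
  push_cast at c
  have hq0 : (q : ℂ) ≠ 0 := by exact_mod_cast (by omega : q ≠ 0)
  have hq2 : (q : ℂ) - 1 ≠ 0 := sub_ne_zero.2 (by exact_mod_cast (by omega : q ≠ 1))
  rw [hr', gaussC, ← mul_div_assoc, eq_div_iff hq2]
  apply mul_left_cancel₀ (pow_ne_zero m hq0)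
  linear_combination c

open Module in
/-- An entry of `matF0 * matFp` at a pair of type plus. -/
theorem matF0_mul_matFp_apply [Fintype F] [FiniteDimensional F V] [Fintype (Submodule F V)]
    {k i : ℕ} {x y w : Submodule F V} (hx : finrank F x = k) (hw : finrank F w = k)
    (hy : finrank F y = k) (hi : finrank F ↥(x ⊓ y) + i = k)
    (hwx : finrank F ↥(w ⊓ x) + 1 = k) (he : w ⊓ y = x ⊓ y) (hs : w ⊔ y ≠ x ⊔ y) :
    (matF0 y * matFp y) w x = ((Fintype.card F : ℂ) - 1) * gaussC (Fintype.card F) i := by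
  set q := Fintype.card F with hq
  have hq1 : 1 < q := Fintype.one_lt_card
  have hk : 1 ≤ k := by omega
  have hew : x ⊓ y ≤ w ⊓ x := le_inf (he.ge.trans inf_le_left) inf_le_left
  have hUT : (w ⊓ x) ⊔ y ≤ w ⊔ y := sup_le_sup_right inf_le_left _
  have hcount := card_covers_mul (le_sup_left : w ⊓ x ≤ (w ⊓ x) ⊔ y) hUT
  have e1 := Submodule.finrank_sup_add_finrank_inf_eq w y
  have e2 := Submodule.finrank_sup_add_finrank_inf_eq (w ⊓ x) y
  have e3 := Submodule.finrank_sup_add_finrank_inf_eq x y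
  have hhy : w ⊓ x ⊓ y = x ⊓ y :=
    le_antisymm (inf_le_inf_right _ inf_le_right) (le_inf hew inf_le_right)
  rw [hhy] at e2
  rw [he] at e1
  have hplus := (typePlus_iff y w x).2 ⟨by omega, by omega, he, hs⟩
  have hsupy : (w ⊔ x) ⊓ y = w ⊓ y :=
    (Submodule.eq_of_le_of_finrank_eq (inf_le_inf_right _ le_sup_left) hplus.1.2.symm).symm
  have hxnot : ¬ x ≤ w ⊔ y := fun h => hs
    (Submodule.eq_of_le_of_finrank_eq (sup_le h le_sup_right) (by omega)).symm
  have hwmem : w ∈ Finset.univ.filter fun z : Submodule F V => w ⊓ x ≤ z ∧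
      finrank F z = finrank F ↥(w ⊓ x) + 1 ∧ z ≤ w ⊔ y ∧ ¬ z ≤ (w ⊓ x) ⊔ y := by
    refine Finset.mem_filter.2 ⟨Finset.mem_univ _, inf_le_left, by omega, le_sup_left, ?_⟩
    intro h
    have := Submodule.finrank_mono (sup_le h le_sup_right : w ⊔ y ≤ (w ⊓ x) ⊔ y)
    omega
  have hset : (Finset.univ.filter fun z : Submodule F V => w ⊓ x ≤ z ∧
      finrank F z = finrank F ↥(w ⊓ x) + 1 ∧ z ≤ w ⊔ y ∧ ¬ z ≤ (w ⊓ x) ⊔ y).erase w =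
      Finset.univ.filter fun z : Submodule F V =>
        (finrank F w = finrank F z ∧ finrank F ↥(w ⊓ z) + 1 = finrank F w ∧
          w ⊓ y = z ⊓ y ∧ w ⊔ y = z ⊔ y) ∧
        (finrank F z = finrank F x ∧ finrank F ↥(z ⊓ x) + 1 = finrank F z ∧
          z ⊓ y = x ⊓ y ∧ z ⊔ y ≠ x ⊔ y) := by
    ext z
    simp only [Finset.mem_erase, Finset.mem_filter, Finset.mem_univ, true_and]
    constructor
    · rintro ⟨hne, h1, h2, h3, h4⟩
      have hzk : finrank F z = k := by omega
      have key : ∀ t : Submodule F V, finrank F t = k → w ⊓ x ≤ t → z ≠ t →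
          t ⊓ z = w ⊓ x := by
        intro t ht h5 h6
        refine (Submodule.eq_of_le_of_finrank_le (le_inf h5 h1) ?_).symm
        have h7 : t ⊓ z < t := lt_of_le_of_ne inf_le_left fun h => h6
          (Submodule.eq_of_le_of_finrank_eq (inf_eq_left.1 h) (by omega)).symm
        have := Submodule.finrank_lt_finrank_of_lt h7
        omega
      have kw := key w hw inf_le_left hne
      have kx := key x hx inf_le_right fun h => hxnot (h ▸ h3)
      have hzy : z ⊓ y = x ⊓ y := by
        refine le_antisymm (le_inf ?_ inf_le_right) (le_inf (hew.trans h1) inf_le_right)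
        intro v hv
        by_contra hvx
        have h6 : v ∉ w ⊓ x := fun h => hvx (inf_le_right (a := w) h)
        apply h4
        rw [← eq_sup_span_singleton h1 h2 (Submodule.mem_inf.1 hv).1 h6]
        refine sup_le_sup_left ?_ _
        simpa using (Submodule.mem_inf.1 hv).2
      have e4 := Submodule.finrank_sup_add_finrank_inf_eq z y
      rw [hzy] at e4
      have hzs : z ⊔ y = w ⊔ y :=
        Submodule.eq_of_le_of_finrank_eq (sup_le h3 le_sup_right) (by omega)
      exact ⟨⟨by omega, by rw [kw]; omega, he.trans hzy.symm, hzs.symm⟩,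
        by omega, by rw [inf_comm z x, kx]; omega, hzy, hzs ▸ hs⟩
    · rintro ⟨⟨a1, a2, a3, a4⟩, b1, b2, b3, b4⟩
      have hne : z ≠ w := by
        rintro rfl
        rw [inf_idem] at a2
        omega
      have h1 : w ⊓ x ≤ z := by
        refine (inf_le_or_le_sup (by omega) (by omega) (by omega) (by omega)).resolve_right ?_
        intro h
        have h5 : z ≤ w := by
          calc z ≤ (w ⊔ y) ⊓ (w ⊔ x) := le_inf (le_sup_left.trans a4.ge) h
            _ = w ⊔ y ⊓ (w ⊔ x) := (sup_inf_assoc_of_le y le_sup_left)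
            _ ≤ w := sup_le le_rfl (by rw [inf_comm, hsupy]; exact inf_le_left)
        exact hne (Submodule.eq_of_le_of_finrank_eq h5 (by omega))
      refine ⟨hne, h1, by omega, le_sup_left.trans a4.ge, fun h => ?_⟩
      have := Submodule.finrank_mono (sup_le h le_sup_right : z ⊔ y ≤ (w ⊓ x) ⊔ y)
      rw [← a4] at this
      omega
  have hentry : (matF0 y * matFp y) w x = ((Finset.univ.filter fun z : Submodule F V =>
        (finrank F w = finrank F z ∧ finrank F ↥(w ⊓ z) + 1 = finrank F w ∧
          w ⊓ y = z ⊓ y ∧ w ⊔ y = z ⊔ y) ∧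
        (finrank F z = finrank F x ∧ finrank F ↥(z ⊓ x) + 1 = finrank F z ∧
          z ⊓ y = x ⊓ y ∧ z ⊔ y ≠ x ⊔ y)).card : ℂ) := by
    simp only [Matrix.mul_apply, matF0_apply, matFp_apply, ite_zero_mul_ite_zero, mul_one,
      Finset.sum_boole]
  rw [hentry, ← hset, Finset.card_erase_of_mem hwmem, Nat.cast_sub (Finset.card_pos.2 ⟨w, hwmem⟩)]
  generalize Finset.card _ = N at hcount ⊢
  obtain ⟨m, rfl⟩ : ∃ m, k = m + 1 := ⟨k - 1, by omega⟩
  have hm : finrank F ↥(w ⊓ x) = m := by omega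
  have hU : finrank F ↥((w ⊓ x) ⊔ y) = m + i := by omega
  have hT : finrank F ↥(w ⊔ y) = m + i + 1 := by omega
  rw [hU, hT, hm] at hcount
  have c := congrArg (Nat.cast : ℕ → ℂ) hcount
  rw [Nat.cast_mul, Nat.cast_sub (Nat.pow_le_pow_right (by omega) (by omega)),
    Nat.cast_sub (Nat.pow_le_pow_right (by omega) (by omega))] at c
  push_cast at c
  have hq0 : (q : ℂ) ≠ 0 := by exact_mod_cast (by omega : q ≠ 0)
  have hq2 : (q : ℂ) - 1 ≠ 0 := sub_ne_zero.2 (by exact_mod_cast (by omega : q ≠ 1))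
  rw [gaussC, mul_div_cancel₀ _ hq2]
  apply mul_left_cancel₀ (pow_ne_zero m hq0)
  apply mul_right_cancel₀ hq2
  push_cast
  linear_combination c

theorem statement13
    (q n k : ℕ) (hq : IsPrimePow q) (hkn : 2 * k < n) (hk : 3 ≤ k)
    (F V : Type) [Field F] [Fintype F] (hcard : Fintype.card F = q)
    [AddCommGroup V] [Module F V] [FiniteDimensional F V]
    (hdim : Module.finrank F V = n)
    [Fintype (Submodule F V)]
    (x y : GrassVertex F V k)
    (i : ℕ) (hi : (Grass F V k).dist x y = i) (hi1 : 1 < i) (hi2 : i < k) :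
    ∀ w ∈ A0set x y, ∀ w' ∈ Apset x y,
      (matF0 y.1 * matFp y.1) w.1 x.1 = 0 ∧
      (matFp y.1 * matF0 y.1) w.1 x.1 = 0 ∧
      (matF0 y.1 * matF0 y.1) w'.1 x.1 = 0 ∧
      (matFp y.1 * matFp y.1) w.1 x.1 = (q : ℂ) ^ (i + 1) * gaussC q (n - k - i) ∧
      (matF0 y.1 * matFp y.1) w'.1 x.1 = ((q : ℂ) - 1) * gaussC q i ∧
      (matFp y.1 * matF0 y.1) w'.1 x.1 = ((q : ℂ) - 1) * gaussC q i := by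
  intro w hw w' hw'
  obtain ⟨-, hw⟩ := hw
  obtain ⟨-, hw'⟩ := hw'
  rw [typeZero_iff] at hw
  rw [typePlus_iff] at hw'
  obtain ⟨-, a2, a3, a4⟩ := hw
  obtain ⟨-, b2, b3, b4⟩ := hw'
  rw [w.2] at a2
  rw [w'.2] at b2
  have hxy := finrank_inf_add_dist x y
  rw [hi] at hxy
  subst hcard hdim
  have hzero : ∀ z : Submodule F V,
      matF0 y.1 w.1 z * matFp y.1 z x.1 = 0 ∧ matFp y.1 w.1 z * matF0 y.1 z x.1 = 0 ∧
        matF0 y.1 w'.1 z * matF0 y.1 z x.1 = 0 := by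
    intro z
    simp only [matF0_apply, matFp_apply, ite_zero_mul_ite_zero]
    refine ⟨if_neg ?_, if_neg ?_, if_neg ?_⟩
    · rintro ⟨⟨-, -, -, h1⟩, -, -, -, h2⟩
      exact h2 (h1.symm.trans a4)
    · rintro ⟨⟨-, -, -, h1⟩, -, -, -, h2⟩
      exact h1 (a4.trans h2.symm)
    · rintro ⟨⟨-, -, -, h1⟩, -, -, -, h2⟩
      exact b4 (h1.trans h2)
  refine ⟨Finset.sum_eq_zero fun z _ => (hzero z).1, Finset.sum_eq_zero fun z _ => (hzero z).2.1,
    Finset.sum_eq_zero fun z _ => (hzero z).2.2,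
    matFp_mul_matFp_apply x.2 w.2 y.2 hxy a2 a3 a4,
    matF0_mul_matFp_apply x.2 w'.2 y.2 hxy b2 b3 b4, ?_⟩
  have hsymm : (matFp y.1 * matF0 y.1) w'.1 x.1 = (matF0 y.1 * matFp y.1) x.1 w'.1 := by
    rw [← Matrix.transpose_apply (matF0 y.1 * matFp y.1), Matrix.transpose_mul,
      matF0_transpose, matFp_transpose]
  rw [hsymm]
  exact matF0_mul_matFp_apply w'.2 x.2 y.2 (by rw [b3]; exact hxy)
    (by rw [inf_comm]; exact b2) b3.symm b4.symm
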